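/- Assume f : ℝⁿ → ℝ and g : ℝᵐ → ℝ are differentiable convex functions with ∇f L₁-Lipschitz and ∇g L₂-Lipschitz, K : ℝⁿ → ℝᵐ is linear with adjoint K*. In the dynamical system (15) take α(t) = (2αt − 2)/t², β(t) = t^b, and ε(t) = 3/t^{b+3}, with constants α ≥ (b + 3)/2, b ≥ 0, 1/(2α − 1) ≤ θ ≤ 1/(b + 2), and t₀ ≥ 1; let (x(t), y(t)) be a twice continuously differentiable global solution of (15) and (x*, y*) a saddle point of L. Then the trajectory (x(t), y(t)) is bounded and there is C > 0 with: (a) L(x(t), y*) − L(x*, y(t)) ≤ C t^{−2−b}; (b) ‖ẋ(t)‖ ≤ C/t and ‖ẏ(t)‖ ≤ C/t; (c) ‖∇f(x(t)) − ∇f(x*)‖ ≤ C t^{−(b+2)/2} and ‖∇g(y(t)) − ∇g(y*)‖ ≤ C t^{−(b+2)/2} for all t ≥ t₀; if 1/(2α − 1) < θ ≤ 1/(b + 2) then ∫_{t₀}^∞ ((2αθ − θ − 1)t − 2θ)(‖ẋ(t)‖² + ‖ẏ(t)‖²) dt < ∞; if 1/(2α − 1) ≤ θ < 1/(b + 2)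 then ∫_{t₀}^∞ t^{b+1}(L(x(t), y*) − L(x*, y(t))) dt < ∞, ∫_{t₀}^∞ t^{b+1}‖∇f(x(t)) − ∇f(x*)‖² dt < ∞, and ∫_{t₀}^∞ t^{b+1}‖∇g(y(t)) − ∇g(y*)‖² dt < ∞; moreover ‖ẋ(t)‖ → 0, ‖ẏ(t)‖ → 0, and L(x(t), y*) − L(x*, y(t)) → 0 as t → ∞, and if b > 0 then L(x(t), y*) − L(x*, y(t)) = o(t^{−b}), ‖∇f(x(t)) − ∇f(x*)‖ = o(t^{−b/2}), and ‖∇g(y(t)) − ∇g(y*)‖ = o(t^{−b/2}). -/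

import Mathlib

open scoped RealInnerProductSpace
open MeasureTheory Filter Asymptotics

noncomputable section

/-- The bilinear Lagrangian `L(x, y) = f(x) + ⟨Kx, y⟩ - g(y)`. -/
def Lag {n m : ℕ} (f : EuclideanSpace ℝ (Fin n) → ℝ) (g : EuclideanSpace ℝ (Fin m) → ℝ)
    (K : EuclideanSpace ℝ (Fin n) →L[ℝ] EuclideanSpace ℝ (Fin m))
    (x : EuclideanSpace ℝ (Fin n)) (y : EuclideanSpace ℝ (Fin m)) : ℝ :=
  f x + ⟪K x, y⟫ - g y

/-- `(x*, y*)` is a saddle point of the Lagrangian `L`: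
`L(x*, y) ≤ L(x*, y*) ≤ L(x, y*)` for all `(x, y)`. -/
def IsSaddle {n m : ℕ} (f : EuclideanSpace ℝ (Fin n) → ℝ) (g : EuclideanSpace ℝ (Fin m) → ℝ)
    (K : EuclideanSpace ℝ (Fin n) →L[ℝ] EuclideanSpace ℝ (Fin m))
    (xs : EuclideanSpace ℝ (Fin n)) (ys : EuclideanSpace ℝ (Fin m)) : Prop :=
  ∀ x y, Lag f g K xs y ≤ Lag f g K xs ys ∧ Lag f g K xs ys ≤ Lag f g K x ys

/-- `(x, y)` is a twice continuously differentiable global solution on `[t₀, ∞)` of the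
Tikhonov regularized second-order primal-dual dynamical system (15):
`ẍ + α(t)ẋ + β(t)[∇f(x) + ε(t)x + K*(y + θtẏ)] = 0`,
`ÿ + α(t)ẏ − β(t)[K(x + θtẋ) − ∇g(y) − ε(t)y] = 0`. -/
def IsSol {n m : ℕ} (t₀ θ : ℝ)
    (f : EuclideanSpace ℝ (Fin n) → ℝ) (g : EuclideanSpace ℝ (Fin m) → ℝ)
    (K : EuclideanSpace ℝ (Fin n) →L[ℝ] EuclideanSpace ℝ (Fin m))
    (α β ε : ℝ → ℝ)
    (x : ℝ → EuclideanSpace ℝ (Fin n)) (y : ℝ → EuclideanSpace ℝ (Fin m)) : Prop :=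
  ContDiffOn ℝ 2 x (Set.Ici t₀) ∧ ContDiffOn ℝ 2 y (Set.Ici t₀) ∧
  ∀ t ≥ t₀,
    deriv (deriv x) t + α t • deriv x t
      + β t • (gradient f (x t) + ε t • x t
        + (ContinuousLinearMap.adjoint K) (y t + (θ * t) • deriv y t)) = 0 ∧
    deriv (deriv y) t + α t • deriv y t
      - β t • (K (x t + (θ * t) • deriv x t) - gradient g (y t) - ε t • y t) = 0

/-- Chain rule for the gradient along a curve. -/
lemma grad_comp {H : Type*} [NormedAddCommGroup H] [InnerProductSpace ℝ H] [CompleteSpace H]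
    (f : H → ℝ) (hf : Differentiable ℝ f) (x : ℝ → H) (p : H) (t : ℝ) (hx : HasDerivAt x p t) :
    HasDerivAt (fun s => f (x s)) ⟪gradient f (x t), p⟫ t := by
  have h2 := (hf (x t)).hasGradientAt.hasFDerivAt.comp_hasDerivAt t hx
  rw [InnerProductSpace.toDual_apply_apply] at h2
  exact h2

/-- First-order convexity inequality. -/
lemma tangent_ineq {H : Type*} [NormedAddCommGroup H] [InnerProductSpace ℝ H] [CompleteSpace H]
    (f : H → ℝ) (hf : Differentiable ℝ f) (hc : ConvexOn ℝ Set.univ f) (u v : H) :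
    f u + ⟪gradient f u, v - u⟫ ≤ f v := by
  have hline : ∀ s : ℝ, HasDerivAt (fun s : ℝ => f (u + s • (v - u)))
      ⟪gradient f (u + s • (v - u)), v - u⟫ s := by
    intro s
    have h1 : HasDerivAt (fun s : ℝ => u + s • (v - u)) (v - u) s := by
      simpa using ((hasDerivAt_id s).smul_const (v - u)).const_add u
    exact grad_comp f hf _ _ s h1
  have hconv : ConvexOn ℝ Set.univ (fun s : ℝ => f (u + s • (v - u))) := by
    refine ⟨convex_univ, ?_⟩
    intro s _ r _ p q hp hq hpq
    have := hc.2 (Set.mem_univ (u + s • (v - u))) (Set.mem_univ (u + r • (v - u))) hp hq hpq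
    have e : p • (u + s • (v - u)) + q • (u + r • (v - u))
        = u + (p • s + q • r) • (v - u) := by
      obtain rfl : q = 1 - p := by linarith
      simp only [smul_eq_mul]
      module
    rw [e] at this
    exact this
  have := hconv.le_slope_of_hasDerivAt (Set.mem_univ 0) (Set.mem_univ 1) zero_lt_one (hline 0)
  rw [slope_def_field] at this
  simp only [zero_smul, one_smul, add_zero, add_sub_cancel, sub_zero, div_one] at this
  linarith

/-- Descent lemma. -/
lemma descent_ineq {H : Type*} [NormedAddCommGroup H] [InnerProductSpace ℝ H] [CompleteSpace H]
    (f : H → ℝ) (hf : Differentiable ℝ f) (L : ℝ)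
    (hL : ∀ u v, ‖gradient f u - gradient f v‖ ≤ L * ‖u - v‖) (u d : H) :
    f (u + d) ≤ f u + ⟪gradient f u, d⟫ + L / 2 * ‖d‖ ^ 2 := by
  have hline : ∀ s : ℝ, HasDerivAt
      (fun s : ℝ => f (u + s • d) - s * ⟪gradient f u, d⟫ - L / 2 * ‖d‖ ^ 2 * s ^ 2)
      (⟪gradient f (u + s • d), d⟫ - ⟪gradient f u, d⟫ - L / 2 * ‖d‖ ^ 2 * (2 * s)) s := by
    intro s
    have h1 : HasDerivAt (fun s : ℝ => u + s • d) d s := by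
      simpa using ((hasDerivAt_id s).smul_const d).const_add u
    have h3 : HasDerivAt (fun s : ℝ => f (u + s • d)) ⟪gradient f (u + s • d), d⟫ s :=
      grad_comp f hf _ _ s h1
    have h4 : HasDerivAt (fun s : ℝ => s * ⟪gradient f u, d⟫) ⟪gradient f u, d⟫ s := by
      simpa using (hasDerivAt_id s).mul_const ⟪gradient f u, d⟫
    have h5 : HasDerivAt (fun s : ℝ => L / 2 * ‖d‖ ^ 2 * s ^ 2) (L / 2 * ‖d‖ ^ 2 * (2 * s)) s := by
      simpa using (hasDerivAt_pow 2 s).const_mul (L / 2 * ‖d‖ ^ 2)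
    exact (h3.sub h4).sub h5
  have hanti : AntitoneOn
      (fun s : ℝ => f (u + s • d) - s * ⟪gradient f u, d⟫ - L / 2 * ‖d‖ ^ 2 * s ^ 2)
      (Set.Icc 0 1) := by
    apply antitoneOn_of_deriv_nonpos (convex_Icc 0 1)
    · exact fun s _ => (hline s).continuousAt.continuousWithinAt
    · exact fun s _ => (hline s).differentiableAt.differentiableWithinAt
    · intro s hs
      rw [interior_Icc] at hs
      rw [(hline s).deriv, ← inner_sub_left]
      have h1 := real_inner_le_norm (gradient f (u + s • d) - gradient f u) d
      have h2 := hL (u + s • d) u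
      have h3 : ‖u + s • d - u‖ = s * ‖d‖ := by
        rw [add_sub_cancel_left, norm_smul, Real.norm_of_nonneg hs.1.le]
      rw [h3] at h2
      have h4 := mul_le_mul_of_nonneg_right h2 (norm_nonneg d)
      nlinarith
  have := hanti (Set.left_mem_Icc.2 zero_le_one) (Set.right_mem_Icc.2 zero_le_one) zero_le_one
  simp only [zero_smul, one_smul, add_zero] at this
  linarith

/-- Bregman distance controls the gradient difference. -/
lemma bregman_ineq {H : Type*} [NormedAddCommGroup H] [InnerProductSpace ℝ H] [CompleteSpace H]
    (f : H → ℝ) (hf : Differentiable ℝ f) (hc : ConvexOn ℝ Set.univ f) (L : ℝ) (hL0 : 0 < L)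
    (hL : ∀ u v, ‖gradient f u - gradient f v‖ ≤ L * ‖u - v‖) (x z : H) :
    ‖gradient f x - gradient f z‖ ^ 2 ≤ 2 * L * (f x - f z - ⟪gradient f z, x - z⟫) := by
  have h1 := descent_ineq f hf L hL x (-(1 / L) • (gradient f x - gradient f z))
  have h2 := tangent_ineq f hf hc z (x + -(1 / L) • (gradient f x - gradient f z))
  set G := gradient f x - gradient f z with hG
  have h3 : ‖-(1 / L) • G‖ ^ 2 = (1 / L) ^ 2 * ‖G‖ ^ 2 := by
    rw [norm_smul, mul_pow, norm_neg, Real.norm_of_nonneg (by positivity)]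
  have h4 : ⟪gradient f x, -(1 / L) • G⟫ - ⟪gradient f z, -(1 / L) • G⟫ = -(1 / L) * ‖G‖ ^ 2 := by
    rw [← inner_sub_left, ← hG, real_inner_smul_right, real_inner_self_eq_norm_sq]
  have h5 : x + -(1 / L) • G - z = (x - z) + -(1 / L) • G := by abel
  rw [h5, inner_add_right] at h2
  rw [h3] at h1
  have h6 : L / 2 * ((1 / L) ^ 2 * ‖G‖ ^ 2) = 1 / L * ‖G‖ ^ 2 / 2 := by
    field_simp
  rw [h6] at h1
  have h7 : 1 / L * ‖G‖ ^ 2 / 2 ≤ f x - f z - ⟪gradient f z, x - z⟫ := by linarith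
  have h8 : 2 * L * (1 / L * ‖G‖ ^ 2 / 2) = ‖G‖ ^ 2 := by field_simp
  rw [← h8]
  exact mul_le_mul_of_nonneg_left h7 (by positivity)

/-- Regularity of the trajectory, one-sided at the initial time. -/
lemma traj_reg {H : Type*} [NormedAddCommGroup H] [NormedSpace ℝ H] (t₀ : ℝ) (x : ℝ → H)
    (hx : ContDiffOn ℝ 2 x (Set.Ici t₀)) :
    ∃ p : ℝ → H, ContinuousOn x (Set.Ici t₀) ∧ ContinuousOn p (Set.Ici t₀) ∧
      ∀ t > t₀, HasDerivAt x (p t) t ∧ HasDerivAt p (deriv (deriv x) t) t ∧ deriv x t = p t := by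
  have hu : UniqueDiffOn ℝ (Set.Ici t₀) := uniqueDiffOn_Ici t₀
  have hp : ContDiffOn ℝ 1 (derivWithin x (Set.Ici t₀)) (Set.Ici t₀) :=
    hx.derivWithin hu (by norm_num)
  have heq : ∀ t > t₀, deriv x t = derivWithin x (Set.Ici t₀) t := fun t ht =>
    (derivWithin_of_mem_nhds (Ici_mem_nhds ht)).symm
  refine ⟨derivWithin x (Set.Ici t₀), hx.continuousOn, hp.continuousOn, fun t ht => ?_⟩
  have h1 : DifferentiableAt ℝ x t :=
    (hx.differentiableOn (by norm_num)).differentiableAt (Ici_mem_nhds ht)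
  have h2 : DifferentiableAt ℝ (derivWithin x (Set.Ici t₀)) t :=
    (hp.differentiableOn (by norm_num)).differentiableAt (Ici_mem_nhds ht)
  refine ⟨heq t ht ▸ h1.hasDerivAt, ?_, heq t ht⟩
  have h3 : deriv x =ᶠ[nhds t] derivWithin x (Set.Ici t₀) := by
    filter_upwards [Ioi_mem_nhds ht] with s hs using heq s hs
  rw [h3.deriv_eq]
  exact h2.hasDerivAt

/-- Gronwall-type estimate. -/
lemma real_part (t₀ A B : ℝ) (ht₀ : 1 ≤ t₀) (hA : 1 ≤ A) (hB : 0 ≤ B) (E e D : ℝ → ℝ)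
    (hEc : ContinuousOn E (Set.Ici t₀)) (hDc : ContinuousOn D (Set.Ici t₀))
    (hD : ∀ t ≥ t₀, 0 ≤ D t) (hE : ∀ t ≥ t₀, 0 ≤ E t)
    (hd : ∀ t > t₀, HasDerivAt E (e t) t)
    (hle : ∀ t > t₀, e t ≤ -D t + A / t ^ 2 * E t + B / t ^ 2) :
    ∃ M, 0 ≤ M ∧ (∀ t ≥ t₀, E t ≤ M) ∧ IntegrableOn D (Set.Ioi t₀) := by
  have hinv : ∀ (c t : ℝ), 0 < t → HasDerivAt (fun t : ℝ => c / t) (-(c / t ^ 2)) t := by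
    intro c t ht
    have := (hasDerivAt_inv ht.ne').const_mul c
    simpa [div_eq_mul_inv] using this
  have hF : ∀ t > t₀, HasDerivAt (fun t => (E t + B) * Real.exp (A / t))
      (e t * Real.exp (A / t) + (E t + B) * (Real.exp (A / t) * (-(A / t ^ 2)))) t := by
    intro t ht
    exact ((hd t ht).add_const B).mul (hinv A t (by linarith)).exp
  have hcinv : ∀ c : ℝ, ContinuousOn (fun t : ℝ => c / t) (Set.Ici t₀) := fun c =>
    fun t ht => (hinv c t (by linarith [Set.mem_Ici.1 ht])).continuousAt.continuousWithinAt
  have hanti : AntitoneOn (fun t => (E t + B) * Real.exp (A / t)) (Set.Ici t₀) := by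
    apply antitoneOn_of_deriv_nonpos (convex_Ici t₀)
    · exact (hEc.add continuousOn_const).mul (hcinv A).rexp
    · intro t ht
      rw [interior_Ici] at ht
      exact (hF t ht).differentiableAt.differentiableWithinAt
    · intro t ht
      rw [interior_Ici] at ht
      rw [(hF t ht).deriv]
      have ht' : t₀ < t := ht
      have htp : 0 < t := by linarith
      have h1 := hle t ht
      have h2 := hD t ht'.le
      have h3 : B / t ^ 2 ≤ A / t ^ 2 * B := by
        rw [div_mul_eq_mul_div]
        gcongr
        nlinarith
      have h4 : e t - A / t ^ 2 * (E t + B) ≤ 0 := by linarith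
      have h5 := mul_nonpos_of_nonpos_of_nonneg h4 (Real.exp_pos (A / t)).le
      linarith
  obtain ⟨M, hM0, hM⟩ : ∃ M, 0 ≤ M ∧ ∀ t ≥ t₀, E t ≤ M := by
    refine ⟨(E t₀ + B) * Real.exp (A / t₀), ?_, fun t ht => ?_⟩
    · have := hE t₀ le_rfl
      positivity
    · have h1 := hanti (Set.mem_Ici.2 le_rfl) (Set.mem_Ici.2 ht) ht
      simp only at h1
      have h2 : 1 ≤ Real.exp (A / t) := Real.one_le_exp (by
        have : 0 < t := by linarith
        positivity)
      have h3 := hE t ht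
      nlinarith
  refine ⟨M, hM0, hM, ?_⟩
  set C := A * M + B with hC
  have hC0 : 0 ≤ C := by positivity
  have hintegral : ∀ s ≥ t₀, ∫ r in t₀..s, D r ≤ E t₀ + C / t₀ := by
    intro s hs
    have hsub : Set.Icc t₀ s ⊆ Set.Ici t₀ := fun r hr => hr.1
    have := intervalIntegral.integral_le_sub_of_hasDeriv_right_of_le
      (g := fun t => -E t - C / t) (g' := fun t => -e t - (-(C / t ^ 2))) (φ := D) hs
      ((hEc.mono hsub).neg.sub ((hcinv C).mono hsub))
      (fun r hr => ((hd r hr.1).neg.sub (hinv C r (by linarith [hr.1]))).hasDerivWithinAt)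
      ((hDc.mono hsub).integrableOn_Icc)
      (fun r hr => by
        have h1 := hle r hr.1
        have hr0 : 0 < r := by linarith [hr.1]
        have h2 : A / r ^ 2 * E r ≤ A / r ^ 2 * M :=
          mul_le_mul_of_nonneg_left (hM r hr.1.le) (by positivity)
        have h3 : C / r ^ 2 = A / r ^ 2 * M + B / r ^ 2 := by rw [hC]; ring
        linarith)
    have h1 := hE s hs
    have h2 : 0 ≤ C / s := by
      have : 0 < s := by linarith
      positivity
    linarith
  refine integrableOn_Ioi_of_intervalIntegral_norm_bounded (ι := ℝ) (l := atTop) (b := id)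
    (E t₀ + C / t₀) t₀ (fun s => ?_) tendsto_id ?_
  · exact ((hDc.mono (fun r hr => hr.1 : Set.Icc t₀ s ⊆ Set.Ici t₀)).integrableOn_Icc).mono_set
      Set.Ioc_subset_Icc_self
  · filter_upwards [eventually_ge_atTop t₀] with s hs
    refine le_trans (le_of_eq ?_) (hintegral s hs)
    apply intervalIntegral.integral_congr
    intro r hr
    rw [id, Set.uIcc_of_le hs] at hr
    exact Real.norm_of_nonneg (hD r hr.1)

/-- One component of the energy: derivative and dissipation estimate. -/
lemma comp_energy {H : Type*} [NormedAddCommGroup H] [InnerProductSpace ℝ H]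
    (θ a b t : ℝ) (ht : 0 < t) (hθ : 0 < θ) (x p : ℝ → H) (q xs G R : H) (φ : ℝ → ℝ)
    (hx : HasDerivAt x (p t) t) (hp : HasDerivAt p q t) (hφ : HasDerivAt φ ⟪G, p t⟫ t)
    (hφle : φ t ≤ ⟪G, x t - xs⟫)
    (hode : q + ((2 * a * t - 2) / t ^ 2) • p t + t ^ b • (G + (3 / t ^ (b + 3)) • x t + R) = 0) :
    ∃ e, HasDerivAt (fun t => θ ^ 2 * t ^ (b + 2) * φ t + 3 * θ ^ 2 / 2 / t * ‖x t‖ ^ 2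
        + 1 / 2 * ‖(x t - xs) + (θ * t) • p t‖ ^ 2
        + (2 * a * θ - θ - 1) / 2 * ‖x t - xs‖ ^ 2) e t ∧
      e ≤ -((θ - θ ^ 2 * (b + 2)) * t ^ (b + 1) * φ t)
        - (2 * a * θ - θ - 1) * θ * t * ‖p t‖ ^ 2
        + (2 + 2 / (3 * θ)) / t ^ 2 * ‖(x t - xs) + (θ * t) • p t‖ ^ 2
        + (3 * θ / 2 * ‖xs‖ ^ 2) / t ^ 2
        - θ * t ^ (b + 1) * ⟪(x t - xs) + (θ * t) • p t, R⟫ := by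
  have hu : HasDerivAt (fun t => x t - xs) (p t) t := hx.sub_const xs
  have hw : HasDerivAt (fun t => (x t - xs) + (θ * t) • p t)
      (p t + ((θ * t) • q + θ • p t)) t := by
    have h0 : HasDerivAt (fun t : ℝ => θ * t) θ t := by
      simpa using (hasDerivAt_id t).const_mul θ
    exact hu.add (h0.smul hp)
  have h1 : HasDerivAt (fun t : ℝ => θ ^ 2 * t ^ (b + 2)) (θ ^ 2 * ((b + 2) * t ^ (b + 1))) t := by
    have := (Real.hasDerivAt_rpow_const (p := b + 2) (Or.inl ht.ne')).const_mul (θ ^ 2)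
    rwa [show b + 2 - 1 = b + 1 by ring] at this
  have h2 : HasDerivAt (fun t : ℝ => 3 * θ ^ 2 / 2 / t) (-(3 * θ ^ 2 / 2 / t ^ 2)) t := by
    have := (hasDerivAt_inv ht.ne').const_mul (3 * θ ^ 2 / 2)
    simpa [div_eq_mul_inv] using this
  have hE := (((h1.mul hφ).add (h2.mul hx.norm_sq)).add (hw.norm_sq.const_mul (1 / 2))).add
    (hu.norm_sq.const_mul ((2 * a * θ - θ - 1) / 2))
  refine ⟨_, hE, ?_⟩
  have e1 : t ^ (b + 1) = t ^ b * t := by rw [Real.rpow_add ht, Real.rpow_one]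
  have e2 : t ^ (b + 2) = t ^ b * t ^ 2 := by
    rw [Real.rpow_add ht]; norm_num
  have e3 : t ^ (b + 3) = t ^ b * t ^ 3 := by
    rw [Real.rpow_add ht]; norm_num
  have hS : 0 < t ^ b := Real.rpow_pos_of_pos ht b
  rw [e3] at hode
  rw [e1, e2]
  generalize t ^ b = S at *
  have hq : q = -(((2 * a * t - 2) / t ^ 2) • p t) - S • (G + R) - (3 / t ^ 3) • x t := by
    have h3 : S • (G + (3 / (S * t ^ 3)) • x t + R) = S • (G + R) + (3 / t ^ 3) • x t := by
      rw [show G + (3 / (S * t ^ 3)) • x t + R = (G + R) + (3 / (S * t ^ 3)) • x t by abel,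
        smul_add, smul_smul]
      congr 2
      field_simp
    rw [h3] at hode
    rw [eq_comm, ← sub_eq_zero, ← neg_eq_zero, ← hode]
    abel
  obtain ⟨u, hu'⟩ : ∃ u, u = x t - xs := ⟨_, rfl⟩
  have hx' : x t = u + xs := by rw [hu']; abel
  rw [← hu'] at hφle ⊢
  rw [hx'] at hq ⊢
  generalize p t = P at *
  generalize φ t = F at *
  have hF : 0 ≤ ⟪G, u⟫ - F := by linarith
  rw [← sub_nonneg]
  have hN : 0 ≤ θ * t * S * (⟪G, u⟫ - F)
      + 3 * θ ^ 2 / (2 * t ^ 2) * ‖u + xs‖ ^ 2 + 3 * θ / (2 * t ^ 2) * ‖u + xs‖ ^ 2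
      + 1 / t ^ 2 * (2 / (3 * θ)) * ‖(u + (θ * t) • P) + (3 * θ / 2) • u‖ ^ 2 := by
    positivity
  refine le_trans hN (le_of_eq ?_)
  rw [hq]
  simp only [← real_inner_self_eq_norm_sq, inner_add_left, inner_add_right,
    inner_sub_right, inner_neg_right, real_inner_smul_left,
    real_inner_smul_right]
  rw [real_inner_comm u P, real_inner_comm u xs, real_inner_comm P xs,
    real_inner_comm G P, real_inner_comm G u]
  field_simp
  ring

/-- Boundedness of `u` from boundedness of the mixed term. -/
lemma u_bound {H : Type*} [NormedAddCommGroup H] [InnerProductSpace ℝ H]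
    (t₀ θ W : ℝ) (ht₀ : 1 ≤ t₀) (hθ : 0 < θ) (u p : ℝ → H)
    (huc : ContinuousOn u (Set.Ici t₀)) (hu : ∀ t > t₀, HasDerivAt u (p t) t)
    (hW : ∀ t ≥ t₀, ‖u t + (θ * t) • p t‖ ^ 2 ≤ W) :
    ∀ t ≥ t₀, ‖u t‖ ^ 2 ≤ W + ‖u t₀‖ ^ 2 := by
  have hd : ∀ t > t₀, HasDerivAt (fun t => (‖u t‖ ^ 2 - W) * t ^ (1 / θ))
      (2 * ⟪u t, p t⟫ * t ^ (1 / θ) + (‖u t‖ ^ 2 - W) * (1 / θ * t ^ (1 / θ - 1))) t := by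
    intro t ht
    have ht0 : t ≠ 0 := by linarith
    exact ((hu t ht).norm_sq.sub_const W).mul (Real.hasDerivAt_rpow_const (Or.inl ht0))
  have hanti : AntitoneOn (fun t => (‖u t‖ ^ 2 - W) * t ^ (1 / θ)) (Set.Ici t₀) := by
    apply antitoneOn_of_deriv_nonpos (convex_Ici t₀)
    · refine ((huc.norm.pow 2).sub continuousOn_const).mul ?_
      exact continuousOn_id.rpow_const fun t ht => Or.inl (by
        have : t₀ ≤ t := ht
        simp only [id]
        linarith)
    · intro t ht
      rw [interior_Ici] at ht
      exact (hd t ht).differentiableAt.differentiableWithinAt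
    · intro t ht
      rw [interior_Ici] at ht
      have ht' : t₀ < t := ht
      have htp : 0 < t := by linarith
      rw [(hd t ht).deriv, Real.rpow_sub_one htp.ne']
      have h1 := hW t ht'.le
      rw [norm_add_sq_real, real_inner_smul_right, norm_smul, mul_pow,
        Real.norm_of_nonneg (by positivity)] at h1
      have h2 : 0 < t ^ (1 / θ) := by positivity
      have h3 : 2 * ⟪u t, p t⟫ * t ^ (1 / θ) + (‖u t‖ ^ 2 - W) * (1 / θ * (t ^ (1 / θ) / t))
          = (t ^ (1 / θ) / (θ * t)) * (2 * (θ * t * ⟪u t, p t⟫) + ‖u t‖ ^ 2 - W) := by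
        field_simp
        ring
      rw [h3]
      apply mul_nonpos_of_nonneg_of_nonpos (by positivity)
      have h4 : 0 ≤ (θ * t) ^ 2 * ‖p t‖ ^ 2 := by positivity
      linarith
  have hW0 : 0 ≤ W := le_trans (by positivity) (hW t₀ le_rfl)
  intro t ht
  have h1 := hanti (Set.mem_Ici.2 le_rfl) (Set.mem_Ici.2 ht) ht
  simp only at h1
  have htp : 0 < t₀ := by linarith
  have htp' : 0 < t := by linarith
  by_contra hcon
  push Not at hcon
  have h2 : t₀ ^ (1 / θ) ≤ t ^ (1 / θ) := Real.rpow_le_rpow htp.le ht (by positivity)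
  have h3 : 0 < t₀ ^ (1 / θ) := by positivity
  have h4 : ‖u t₀‖ ^ 2 < ‖u t‖ ^ 2 - W := by linarith
  have h5 : 0 ≤ ‖u t₀‖ ^ 2 := by positivity
  have h6 : ‖u t₀‖ ^ 2 * t₀ ^ (1 / θ) < (‖u t‖ ^ 2 - W) * t ^ (1 / θ) := by
    nlinarith
  nlinarith

/-- Position and velocity bounds for one component. -/
lemma vel_bound {H : Type*} [NormedAddCommGroup H] [InnerProductSpace ℝ H]
    (t₀ θ W : ℝ) (ht₀ : 1 ≤ t₀) (hθ : 0 < θ) (x p : ℝ → H) (xs : H)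
    (hxc : ContinuousOn x (Set.Ici t₀)) (hx : ∀ t > t₀, HasDerivAt x (p t) t)
    (hW : ∀ t ≥ t₀, ‖(x t - xs) + (θ * t) • p t‖ ^ 2 ≤ W) :
    ∃ C, 0 ≤ C ∧ ∀ t ≥ t₀, ‖x t‖ ≤ C ∧ ‖deriv x t‖ ≤ C / t := by
  have hu := u_bound t₀ θ W ht₀ hθ (fun t => x t - xs) p (hxc.sub continuousOn_const)
    (fun t ht => (hx t ht).sub_const xs) hW
  set U := W + ‖x t₀ - xs‖ ^ 2 with hU
  have hU' : ∀ t ≥ t₀, ‖x t - xs‖ ≤ √U := fun t ht => Real.le_sqrt_of_sq_le (hu t ht)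
  have hW' : ∀ t ≥ t₀, ‖(x t - xs) + (θ * t) • p t‖ ≤ √W := fun t ht =>
    Real.le_sqrt_of_sq_le (hW t ht)
  have hU0 := Real.sqrt_nonneg U
  have hW0 := Real.sqrt_nonneg W
  have c1 : 0 ≤ (√U + √W) / θ := by positivity
  have c2 : 0 ≤ ‖deriv x t₀‖ * t₀ := by positivity
  have c3 := norm_nonneg xs
  refine ⟨(√U + ‖xs‖) + (√U + √W) / θ + ‖deriv x t₀‖ * t₀, by linarith, fun t ht => ⟨?_, ?_⟩⟩
  · have h1 := norm_add_le (x t - xs) xs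
    rw [sub_add_cancel] at h1
    linarith [hU' t ht]
  · have htp : 0 < t := by linarith
    rw [le_div_iff₀ htp]
    rcases eq_or_lt_of_le ht with rfl | hlt
    · linarith
    · rw [(hx t hlt).deriv]
      have h1 := norm_sub_le ((x t - xs) + (θ * t) • p t) (x t - xs)
      rw [add_sub_cancel_left, norm_smul, Real.norm_of_nonneg (by positivity)] at h1
      have h2 : ‖p t‖ * t ≤ (√U + √W) / θ := by
        rw [le_div_iff₀ hθ]
        nlinarith [hU' t ht, hW' t ht]
      linarith

lemma grad_bound (c F G t b : ℝ) (ht : 0 < t) (hG : 0 ≤ G) (hc : 0 ≤ c)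
    (h1 : G ^ 2 ≤ F) (h2 : F ≤ c * t ^ (-2 - b)) : G ≤ √c * t ^ (-(b + 2) / 2) := by
  rw [← pow_le_pow_iff_left₀ hG (by positivity) two_ne_zero, mul_pow, Real.sq_sqrt hc,
    ← Real.rpow_natCast (t ^ (-(b + 2) / 2)) 2, ← Real.rpow_mul ht.le]
  refine (h1.trans h2).trans (le_of_eq ?_)
  congr 2
  push_cast
  ring

lemma littleO_aux (h : ℝ → ℝ) (t₀ C r s : ℝ) (hrs : r < s)
    (hh : ∀ t ≥ t₀, 0 ≤ h t ∧ h t ≤ C * t ^ r) : h =o[atTop] fun t : ℝ => t ^ s := by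
  have h1 : h =O[atTop] fun t : ℝ => t ^ r := by
    refine IsBigO.of_bound C ?_
    filter_upwards [eventually_ge_atTop t₀, eventually_gt_atTop 0] with t ht ht'
    rw [Real.norm_of_nonneg (hh t ht).1, Real.norm_of_nonneg (by positivity)]
    exact (hh t ht).2
  refine h1.trans_isLittleO ?_
  refine isLittleO_of_tendsto' ?_ ?_
  · filter_upwards [eventually_gt_atTop 0] with t ht h0
    exact absurd h0 (by positivity)
  · refine (tendsto_rpow_neg_atTop (sub_pos.2 hrs)).congr' ?_
    filter_upwards [eventually_gt_atTop 0] with t ht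
    rw [← Real.rpow_sub ht]
    congr 1
    ring

lemma intOn_dom (t₀ c : ℝ) (D h : ℝ → ℝ) (hD : IntegrableOn D (Set.Ioi t₀))
    (hc : ContinuousOn h (Set.Ici t₀)) (hle : ∀ t > t₀, |h t| ≤ c * D t) :
    IntegrableOn h (Set.Ioi t₀) := by
  refine Integrable.mono' (hD.const_mul c)
    ((hc.mono Set.Ioi_subset_Ici_self).aestronglyMeasurable measurableSet_Ioi) ?_
  filter_upwards [ae_restrict_mem measurableSet_Ioi] with t ht
  exact hle t ht

lemma saddle_grad {n m : ℕ} (f : EuclideanSpace ℝ (Fin n) → ℝ) (g : EuclideanSpace ℝ (Fin m) → ℝ)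
    (hf : Differentiable ℝ f) (hg : Differentiable ℝ g)
    (K : EuclideanSpace ℝ (Fin n) →L[ℝ] EuclideanSpace ℝ (Fin m))
    (xs : EuclideanSpace ℝ (Fin n)) (ys : EuclideanSpace ℝ (Fin m))
    (hsaddle : IsSaddle f g K xs ys) :
    gradient f xs = -(ContinuousLinearMap.adjoint K ys) ∧ gradient g ys = K xs := by
  constructor
  · rw [eq_neg_iff_add_eq_zero, ← inner_self_eq_zero (𝕜 := ℝ)]
    set d := gradient f xs + ContinuousLinearMap.adjoint K ys with hd
    have h1 : HasDerivAt (fun s : ℝ => xs + s • d) d 0 := by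
      simpa using ((hasDerivAt_id (0 : ℝ)).smul_const d).const_add xs
    have h2 := grad_comp f hf _ _ 0 h1
    have h3 : HasDerivAt (fun s : ℝ => ⟪xs + s • d, ContinuousLinearMap.adjoint K ys⟫)
        ⟪d, ContinuousLinearMap.adjoint K ys⟫ 0 := by
      simpa using h1.inner ℝ (hasDerivAt_const (0 : ℝ) (ContinuousLinearMap.adjoint K ys))
    have h4 : IsLocalMin (fun s : ℝ => f (xs + s • d)
        + ⟪xs + s • d, ContinuousLinearMap.adjoint K ys⟫) 0 := by
      refine Filter.Eventually.of_forall fun s => ?_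
      have := (hsaddle (xs + s • d) ys).2
      simp only [Lag] at this
      simp only [zero_smul, add_zero, ContinuousLinearMap.adjoint_inner_right]
      linarith
    have h5 := h4.hasDerivAt_eq_zero (h2.add h3)
    rw [zero_smul, add_zero, real_inner_comm d] at h5
    rw [← h5, ← inner_add_right, ← hd]
  · rw [← sub_eq_zero, ← inner_self_eq_zero (𝕜 := ℝ)]
    set d := gradient g ys - K xs with hd
    have h1 : HasDerivAt (fun s : ℝ => ys + s • d) d 0 := by
      simpa using ((hasDerivAt_id (0 : ℝ)).smul_const d).const_add ys
    have h2 := grad_comp g hg _ _ 0 h1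
    have h3 : HasDerivAt (fun s : ℝ => ⟪K xs, ys + s • d⟫) ⟪K xs, d⟫ 0 := by
      simpa using (hasDerivAt_const (0 : ℝ) (K xs)).inner ℝ h1
    have h4 : IsLocalMin (fun s : ℝ => g (ys + s • d) - ⟪K xs, ys + s • d⟫) 0 := by
      refine Filter.Eventually.of_forall fun s => ?_
      have := (hsaddle xs (ys + s • d)).1
      simp only [Lag] at this
      simp only [zero_smul, add_zero]
      linarith
    have h5 := h4.hasDerivAt_eq_zero (h2.sub h3)
    rw [zero_smul, add_zero, ← inner_sub_left, ← hd] at h5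
    exact h5

set_option maxHeartbeats 4000000

/-- Theorem 3.5, Case 2: `α(t) = (2at − 2)/t²`, `β(t) = t^b`,
`ε(t) = 3/t^{b+3}`: boundedness, convergence rates, integral estimates and
asymptotic vanishing along any solution of (15). -/
theorem stmt_19 {n m : ℕ} (t₀ θ a b L₁ L₂ : ℝ)
    (ht₀ : 1 ≤ t₀) (ha : (b + 3) / 2 ≤ a) (hb : 0 ≤ b)
    (hθ1 : 1 / (2 * a - 1) ≤ θ) (hθ2 : θ ≤ 1 / (b + 2))
    (hL₁ : 0 < L₁) (hL₂ : 0 < L₂)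
    (f : EuclideanSpace ℝ (Fin n) → ℝ) (g : EuclideanSpace ℝ (Fin m) → ℝ)
    (hf : Differentiable ℝ f) (hg : Differentiable ℝ g)
    (hfconv : ConvexOn ℝ Set.univ f) (hgconv : ConvexOn ℝ Set.univ g)
    (hfLip : ∀ u v, ‖gradient f u - gradient f v‖ ≤ L₁ * ‖u - v‖)
    (hgLip : ∀ u v, ‖gradient g u - gradient g v‖ ≤ L₂ * ‖u - v‖)
    (K : EuclideanSpace ℝ (Fin n) →L[ℝ] EuclideanSpace ℝ (Fin m))
    (x : ℝ → EuclideanSpace ℝ (Fin n)) (y : ℝ → EuclideanSpace ℝ (Fin m))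
    (hsol : IsSol t₀ θ f g K (fun t => (2 * a * t - 2) / t ^ 2) (fun t => t ^ b)
      (fun t => 3 / t ^ (b + 3)) x y)
    (xs : EuclideanSpace ℝ (Fin n)) (ys : EuclideanSpace ℝ (Fin m))
    (hsaddle : IsSaddle f g K xs ys) :
    (∃ M : ℝ, ∀ t ≥ t₀, ‖x t‖ ≤ M ∧ ‖y t‖ ≤ M) ∧
    (∃ C > 0, ∀ t ≥ t₀,
      Lag f g K (x t) ys - Lag f g K xs (y t) ≤ C * t ^ (-2 - b) ∧
      ‖deriv x t‖ ≤ C / t ∧ ‖deriv y t‖ ≤ C / t ∧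
      ‖gradient f (x t) - gradient f xs‖ ≤ C * t ^ (-(b + 2) / 2) ∧
      ‖gradient g (y t) - gradient g ys‖ ≤ C * t ^ (-(b + 2) / 2)) ∧
    (1 / (2 * a - 1) < θ →
      IntegrableOn
        (fun t => ((2 * a * θ - θ - 1) * t - 2 * θ)
          * (‖deriv x t‖ ^ 2 + ‖deriv y t‖ ^ 2)) (Set.Ioi t₀)) ∧
    (θ < 1 / (b + 2) →
      IntegrableOn
        (fun t => t ^ (b + 1) * (Lag f g K (x t) ys - Lag f g K xs (y t)))
        (Set.Ioi t₀) ∧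
      IntegrableOn
        (fun t => t ^ (b + 1) * ‖gradient f (x t) - gradient f xs‖ ^ 2)
        (Set.Ioi t₀) ∧
      IntegrableOn
        (fun t => t ^ (b + 1) * ‖gradient g (y t) - gradient g ys‖ ^ 2)
        (Set.Ioi t₀)) ∧
    Tendsto (fun t => ‖deriv x t‖) atTop (nhds 0) ∧
    Tendsto (fun t => ‖deriv y t‖) atTop (nhds 0) ∧
    Tendsto (fun t => Lag f g K (x t) ys - Lag f g K xs (y t)) atTop (nhds 0) ∧
    (0 < b →
      ((fun t => Lag f g K (x t) ys - Lag f g K xs (y t)) =o[atTop]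
        fun t => t ^ (-b)) ∧
      ((fun t => ‖gradient f (x t) - gradient f xs‖) =o[atTop]
        fun t => t ^ (-b / 2)) ∧
      ((fun t => ‖gradient g (y t) - gradient g ys‖) =o[atTop]
        fun t => t ^ (-b / 2))) := by
  obtain ⟨hcx, hcy, hode⟩ := hsol
  obtain ⟨px, hxc, hpxc, hpx⟩ := traj_reg t₀ x hcx
  obtain ⟨py, hyc, hpyc, hpy⟩ := traj_reg t₀ y hcy
  obtain ⟨hgx, hgy⟩ := saddle_grad f g hf hg K xs ys hsaddle
  have h2a : 0 < 2 * a - 1 := by linarith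
  have hθ : 0 < θ := lt_of_lt_of_le (by positivity) hθ1
  have hc0 : 0 ≤ 2 * a * θ - θ - 1 := by
    rw [div_le_iff₀ h2a] at hθ1
    linarith
  have hb2 : 0 < b + 2 := by linarith
  have hd0 : 0 ≤ θ - θ ^ 2 * (b + 2) := by
    rw [le_div_iff₀ hb2] at hθ2
    nlinarith
  set φx : ℝ → ℝ := fun t => f (x t) - f xs - ⟪gradient f xs, x t - xs⟫ with hφx
  set φy : ℝ → ℝ := fun t => g (y t) - g ys - ⟪gradient g ys, y t - ys⟫ with hφy
  have hLag : ∀ t, Lag f g K (x t) ys - Lag f g K xs (y t) = φx t + φy t := by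
    intro t
    simp only [Lag, hφx, hφy, hgx, hgy, inner_neg_left, inner_sub_right,
      ContinuousLinearMap.adjoint_inner_left]
    rw [real_inner_comm (K (x t)), real_inner_comm (K xs) ys]
    ring
  have hφx0 : ∀ t, 0 ≤ φx t := fun t => by
    have := tangent_ineq f hf hfconv xs (x t)
    simp only [hφx]; linarith
  have hφy0 : ∀ t, 0 ≤ φy t := fun t => by
    have := tangent_ineq g hg hgconv ys (y t)
    simp only [hφy]; linarith
  have hφxc : ContinuousOn φx (Set.Ici t₀) :=
    ((hf.continuous.comp_continuousOn hxc).sub continuousOn_const).sub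
      (continuousOn_const.inner (𝕜 := ℝ) (hxc.sub continuousOn_const))
  have hφyc : ContinuousOn φy (Set.Ici t₀) :=
    ((hg.continuous.comp_continuousOn hyc).sub continuousOn_const).sub
      (continuousOn_const.inner (𝕜 := ℝ) (hyc.sub continuousOn_const))
  have hne : ∀ t ∈ Set.Ici t₀, (t : ℝ) ≠ 0 := fun t ht => by
    have : t₀ ≤ t := ht
    linarith
  have hrpc : ∀ r : ℝ, ContinuousOn (fun t : ℝ => t ^ r) (Set.Ici t₀) := fun r =>
    continuousOn_id.rpow_const fun t ht => Or.inl (hne t ht)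
  set wx := fun t => (x t - xs) + (θ * t) • px t with hwx
  set wy := fun t => (y t - ys) + (θ * t) • py t with hwy
  set Ex := fun t => θ ^ 2 * t ^ (b + 2) * φx t + 3 * θ ^ 2 / 2 / t * ‖x t‖ ^ 2
        + 1 / 2 * ‖(x t - xs) + (θ * t) • px t‖ ^ 2
        + (2 * a * θ - θ - 1) / 2 * ‖x t - xs‖ ^ 2 with hEx
  set Ey := fun t => θ ^ 2 * t ^ (b + 2) * φy t + 3 * θ ^ 2 / 2 / t * ‖y t‖ ^ 2
        + 1 / 2 * ‖(y t - ys) + (θ * t) • py t‖ ^ 2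
        + (2 * a * θ - θ - 1) / 2 * ‖y t - ys‖ ^ 2 with hEy
  have hExc : ContinuousOn Ex (Set.Ici t₀) := by
    have := hrpc (b + 2)
    have h2 : ContinuousOn (fun t : ℝ => 3 * θ ^ 2 / 2 / t) (Set.Ici t₀) :=
      continuousOn_const.div continuousOn_id hne
    simp only [hEx]
    fun_prop
  have hEyc : ContinuousOn Ey (Set.Ici t₀) := by
    have := hrpc (b + 2)
    have h2 : ContinuousOn (fun t : ℝ => 3 * θ ^ 2 / 2 / t) (Set.Ici t₀) :=
      continuousOn_const.div continuousOn_id hne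
    simp only [hEy]
    fun_prop
  have hExl : ∀ t ≥ t₀, θ ^ 2 * t ^ (b + 2) * φx t + 1 / 2 * ‖wx t‖ ^ 2 ≤ Ex t := by
    intro t ht
    have htp : 0 < t := by linarith
    have h1 : 0 ≤ 3 * θ ^ 2 / 2 / t * ‖x t‖ ^ 2 := by positivity
    have h2 : 0 ≤ (2 * a * θ - θ - 1) / 2 * ‖x t - xs‖ ^ 2 := by positivity
    simp only [hEx, hwx]
    linarith
  have hEyl : ∀ t ≥ t₀, θ ^ 2 * t ^ (b + 2) * φy t + 1 / 2 * ‖wy t‖ ^ 2 ≤ Ey t := by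
    intro t ht
    have htp : 0 < t := by linarith
    have h1 : 0 ≤ 3 * θ ^ 2 / 2 / t * ‖y t‖ ^ 2 := by positivity
    have h2 : 0 ≤ (2 * a * θ - θ - 1) / 2 * ‖y t - ys‖ ^ 2 := by positivity
    simp only [hEy, hwy]
    linarith
  have hder : ∀ t > t₀, ∃ e, HasDerivAt (fun t => Ex t + Ey t) e t ∧
      e ≤ -((θ - θ ^ 2 * (b + 2)) * t ^ (b + 1) * (φx t + φy t)
        + (2 * a * θ - θ - 1) * θ * t * (‖px t‖ ^ 2 + ‖py t‖ ^ 2))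
        + (2 + 2 / (3 * θ)) / t ^ 2 * (‖wx t‖ ^ 2 + ‖wy t‖ ^ 2)
        + (3 * θ / 2 * (‖xs‖ ^ 2 + ‖ys‖ ^ 2)) / t ^ 2 := by
    intro t ht
    have htp : 0 < t := by linarith
    obtain ⟨o1, o2⟩ := hode t ht.le
    obtain ⟨dx1, dx2, dx3⟩ := hpx t ht
    obtain ⟨dy1, dy2, dy3⟩ := hpy t ht
    rw [dx3, dy3] at o1 o2
    have hgradx : HasDerivAt φx ⟪gradient f (x t) - gradient f xs, px t⟫ t := by
      rw [inner_sub_left]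
      have h3 : HasDerivAt (fun s => ⟪gradient f xs, x s - xs⟫) ⟪gradient f xs, px t⟫ t := by
        simpa using (hasDerivAt_const t (gradient f xs)).inner ℝ (dx1.sub_const xs)
      exact ((grad_comp f hf x _ t dx1).sub_const (f xs)).sub h3
    have hgrady : HasDerivAt φy ⟪gradient g (y t) - gradient g ys, py t⟫ t := by
      rw [inner_sub_left]
      have h3 : HasDerivAt (fun s => ⟪gradient g ys, y s - ys⟫) ⟪gradient g ys, py t⟫ t := by
        simpa using (hasDerivAt_const t (gradient g ys)).inner ℝ (dy1.sub_const ys)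
      exact ((grad_comp g hg y _ t dy1).sub_const (g ys)).sub h3
    obtain ⟨e1, he1, hle1⟩ := comp_energy θ a b t htp hθ x px (deriv (deriv x) t) xs
      (gradient f (x t) - gradient f xs) (ContinuousLinearMap.adjoint K (wy t)) φx dx1 dx2 hgradx
      (by
        have := tangent_ineq f hf hfconv (x t) xs
        rw [← neg_sub (x t) xs, inner_neg_right] at this
        simp only [hφx, inner_sub_left]
        linarith)
      (by
        rw [← o1]
        congr 2
        rw [hgx]
        simp only [hwy, map_add, map_sub]
        abel)
    obtain ⟨e2, he2, hle2⟩ := comp_energy θ a b t htp hθ y py (deriv (deriv y) t) ys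
      (gradient g (y t) - gradient g ys) (-(K (wx t))) φy dy1 dy2 hgrady
      (by
        have := tangent_ineq g hg hgconv (y t) ys
        rw [← neg_sub (y t) ys, inner_neg_right] at this
        simp only [hφy, inner_sub_left]
        linarith)
      (by
        rw [← o2, sub_eq_add_neg _ (t ^ b • _), ← smul_neg]
        congr 2
        rw [hgy]
        simp only [hwx, map_add, map_sub]
        abel)
    refine ⟨e1 + e2, he1.add he2, ?_⟩
    have hcross : ⟪wx t, ContinuousLinearMap.adjoint K (wy t)⟫ + ⟪wy t, -(K (wx t))⟫ = 0 := by
      rw [ContinuousLinearMap.adjoint_inner_right, inner_neg_right,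
        real_inner_comm (K (wx t)) (wy t)]
      ring
    have hcross' : θ * t ^ (b + 1) * ⟪wx t, ContinuousLinearMap.adjoint K (wy t)⟫
        + θ * t ^ (b + 1) * ⟪wy t, -(K (wx t))⟫ = 0 := by
      rw [← mul_add, hcross, mul_zero]
    simp only [hwx, hwy] at hcross' hle1 hle2 ⊢
    refine (add_le_add hle1 hle2).trans (le_of_eq ?_)
    linear_combination -hcross'
  set D := fun t => (θ - θ ^ 2 * (b + 2)) * t ^ (b + 1) * (φx t + φy t)
        + (2 * a * θ - θ - 1) * θ * t * (‖px t‖ ^ 2 + ‖py t‖ ^ 2) with hD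
  have hD1 : ∀ t ≥ t₀, 0 ≤ (θ - θ ^ 2 * (b + 2)) * t ^ (b + 1) * (φx t + φy t) := fun t ht => by
    have htp : 0 < t := by linarith
    have := hφx0 t
    have := hφy0 t
    positivity
  have hD2 : ∀ t ≥ t₀, 0 ≤ (2 * a * θ - θ - 1) * θ * t * (‖px t‖ ^ 2 + ‖py t‖ ^ 2) :=
    fun t ht => by
      have htp : 0 < t := by linarith
      positivity
  have hDc : ContinuousOn D (Set.Ici t₀) := by
    have := hrpc (b + 1)
    simp only [hD]
    fun_prop
  have hpow : ∀ t ≥ t₀, 0 ≤ θ ^ 2 * t ^ (b + 2) * φx t ∧ 0 ≤ θ ^ 2 * t ^ (b + 2) * φy t :=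
    fun t ht => by
      have htp : 0 < t := by linarith
      have := hφx0 t
      have := hφy0 t
      constructor <;> positivity
  obtain ⟨M, hM0, hM, hDint⟩ := real_part t₀ (2 * (2 + 2 / (3 * θ)))
    (3 * θ / 2 * (‖xs‖ ^ 2 + ‖ys‖ ^ 2)) ht₀
    (by have : 0 < 2 / (3 * θ) := by positivity
        linarith) (by positivity)
    (fun t => Ex t + Ey t) (fun t => deriv (fun t => Ex t + Ey t) t) D (hExc.add hEyc) hDc
    (fun t ht => add_nonneg (hD1 t ht) (hD2 t ht))
    (fun t ht => by
      have h1 := hExl t ht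
      have h2 := hEyl t ht
      have h3 := hpow t ht
      have h4 := sq_nonneg ‖wx t‖
      have h5 := sq_nonneg ‖wy t‖
      show 0 ≤ Ex t + Ey t
      linarith)
    (fun t ht => by
      obtain ⟨e, he, -⟩ := hder t ht
      exact he.differentiableAt.hasDerivAt)
    (fun t ht => by
      obtain ⟨e, he, hle⟩ := hder t ht
      have htp : 0 < t := by linarith
      rw [he.deriv]
      have h1 := hExl t ht.le
      have h2 := hEyl t ht.le
      have h3 := hpow t ht.le
      have h4 : ‖wx t‖ ^ 2 + ‖wy t‖ ^ 2 ≤ 2 * (Ex t + Ey t) := by linarith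
      have h5 : (2 + 2 / (3 * θ)) / t ^ 2 * (‖wx t‖ ^ 2 + ‖wy t‖ ^ 2)
          ≤ (2 + 2 / (3 * θ)) / t ^ 2 * (2 * (Ex t + Ey t)) :=
        mul_le_mul_of_nonneg_left h4 (by positivity)
      have h6 : (2 + 2 / (3 * θ)) / t ^ 2 * (2 * (Ex t + Ey t))
          = 2 * (2 + 2 / (3 * θ)) / t ^ 2 * (Ex t + Ey t) := by ring
      linarith)
  have hbnd : ∀ t ≥ t₀, θ ^ 2 * t ^ (b + 2) * (φx t + φy t) ≤ M ∧ ‖wx t‖ ^ 2 ≤ 2 * M ∧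
      ‖wy t‖ ^ 2 ≤ 2 * M := fun t ht => by
    have h1 := hExl t ht
    have h2 := hEyl t ht
    have h3 := hpow t ht
    have h4 := sq_nonneg ‖wx t‖
    have h5 := sq_nonneg ‖wy t‖
    have h6 := hM t ht
    refine ⟨?_, ?_, ?_⟩ <;> linarith
  obtain ⟨Cx, hCx0, hCx⟩ := vel_bound t₀ θ (2 * M) ht₀ hθ x px xs hxc (fun t ht => (hpx t ht).1)
    (fun t ht => (hbnd t ht).2.1)
  obtain ⟨Cy, hCy0, hCy⟩ := vel_bound t₀ θ (2 * M) ht₀ hθ y py ys hyc (fun t ht => (hpy t ht).1)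
    (fun t ht => (hbnd t ht).2.2)
  have hφb : ∀ t ≥ t₀, φx t + φy t ≤ M / θ ^ 2 * t ^ (-2 - b) := fun t ht => by
    have htp : 0 < t := by linarith
    have h1 := (hbnd t ht).1
    have h2 : t ^ (-2 - b) = (t ^ (b + 2))⁻¹ := by
      rw [← Real.rpow_neg htp.le]
      congr 1
      ring
    have h3 : 0 < t ^ (b + 2) := by positivity
    rw [h2, ← div_eq_mul_inv, div_div, le_div_iff₀ (by positivity)]
    linarith
  have hGx := fun t => bregman_ineq f hf hfconv L₁ hL₁ hfLip (x t) xs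
  have hGy := fun t => bregman_ineq g hg hgconv L₂ hL₂ hgLip (y t) ys
  have hGxb : ∀ t ≥ t₀, ‖gradient f (x t) - gradient f xs‖
      ≤ √(2 * L₁ * (M / θ ^ 2)) * t ^ (-(b + 2) / 2) := fun t ht =>
    grad_bound _ _ _ t b (by linarith) (norm_nonneg _) (by positivity) (hGx t) (by
      rw [mul_assoc (2 * L₁)]
      refine mul_le_mul_of_nonneg_left ?_ (by positivity)
      have h1 := hφb t ht
      have h2 := hφy0 t
      exact le_trans (by simp only [hφx] at *; linarith) h1)
  have hGyb : ∀ t ≥ t₀, ‖gradient g (y t) - gradient g ys‖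
      ≤ √(2 * L₂ * (M / θ ^ 2)) * t ^ (-(b + 2) / 2) := fun t ht =>
    grad_bound _ _ _ t b (by linarith) (norm_nonneg _) (by positivity) (hGy t) (by
      rw [mul_assoc (2 * L₂)]
      refine mul_le_mul_of_nonneg_left ?_ (by positivity)
      have h1 := hφb t ht
      have h2 := hφx0 t
      exact le_trans (by simp only [hφy] at *; linarith) h1)
  have hfgc : Continuous (gradient f) := by
    refine (LipschitzWith.of_dist_le_mul (K := L₁.toNNReal) fun u v => ?_).continuous
    rw [dist_eq_norm, dist_eq_norm, Real.coe_toNNReal _ hL₁.le]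
    exact hfLip u v
  have hggc : Continuous (gradient g) := by
    refine (LipschitzWith.of_dist_le_mul (K := L₂.toNNReal) fun u v => ?_).continuous
    rw [dist_eq_norm, dist_eq_norm, Real.coe_toNNReal _ hL₂.le]
    exact hgLip u v
  simp only [hLag]
  have hvel : ∀ C : ℝ, Tendsto (fun t : ℝ => C / t) atTop (nhds 0) := fun C =>
    tendsto_const_nhds.div_atTop tendsto_id
  refine ⟨⟨Cx + Cy, fun t ht => ⟨by linarith [(hCx t ht).1], by linarith [(hCy t ht).1]⟩⟩,
    ?_, ?_, ?_, ?_, ?_, ?_, ?_⟩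
  · have n1 : 0 ≤ M / θ ^ 2 := by positivity
    have n2 := Real.sqrt_nonneg (2 * L₁ * (M / θ ^ 2))
    have n3 := Real.sqrt_nonneg (2 * L₂ * (M / θ ^ 2))
    refine ⟨1 + Cx + Cy + M / θ ^ 2 + √(2 * L₁ * (M / θ ^ 2)) + √(2 * L₂ * (M / θ ^ 2)),
      by linarith, fun t ht => ?_⟩
    have htp : 0 < t := by linarith
    refine ⟨(hφb t ht).trans ?_, (hCx t ht).2.trans ?_, (hCy t ht).2.trans ?_,
      (hGxb t ht).trans ?_, (hGyb t ht).trans ?_⟩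
    · exact mul_le_mul_of_nonneg_right (by linarith) (by positivity)
    · exact div_le_div_of_nonneg_right (by linarith) htp.le
    · exact div_le_div_of_nonneg_right (by linarith) htp.le
    · exact mul_le_mul_of_nonneg_right (by linarith) (by positivity)
    · exact mul_le_mul_of_nonneg_right (by linarith) (by positivity)
  · intro hs
    have hc1 : 0 < 2 * a * θ - θ - 1 := by
      rw [div_lt_iff₀ h2a] at hs
      linarith
    have h1 : IntegrableOn (fun t => ((2 * a * θ - θ - 1) * t - 2 * θ)
          * (‖px t‖ ^ 2 + ‖py t‖ ^ 2)) (Set.Ioi t₀) := by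
      refine intOn_dom t₀ (1 / θ + 2 / (2 * a * θ - θ - 1)) D _ hDint (by fun_prop) ?_
      intro t ht
      have ht1 : 1 ≤ t := by linarith
      have htp : 0 < t := by linarith
      rw [abs_mul, abs_of_nonneg (by positivity : 0 ≤ ‖px t‖ ^ 2 + ‖py t‖ ^ 2)]
      have h2 : |(2 * a * θ - θ - 1) * t - 2 * θ| ≤ (2 * a * θ - θ - 1) * t + 2 * θ * t := by
        rw [abs_le]
        constructor <;> nlinarith [mul_pos hc1 htp]
      refine (mul_le_mul_of_nonneg_right h2 (by positivity)).trans ?_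
      have h3 : ((2 * a * θ - θ - 1) * t + 2 * θ * t) * (‖px t‖ ^ 2 + ‖py t‖ ^ 2)
          = (1 / θ + 2 / (2 * a * θ - θ - 1)) *
            ((2 * a * θ - θ - 1) * θ * t * (‖px t‖ ^ 2 + ‖py t‖ ^ 2)) := by
        have hc2 : ∀ c N : ℝ, 0 < c → (c * t + 2 * θ * t) * N
            = (1 / θ + 2 / c) * (c * θ * t * N) := by
          intro c N hc
          field_simp
        exact hc2 _ _ hc1
      rw [h3]
      refine mul_le_mul_of_nonneg_left ?_ (by positivity)
      simp only [hD]
      linarith [hD1 t ht.le]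
    refine h1.congr_fun ?_ measurableSet_Ioi
    intro t ht
    simp only [(hpx t ht).2.2, (hpy t ht).2.2]
  · intro hs
    have hd1 : 0 < θ - θ ^ 2 * (b + 2) := by
      rw [lt_div_iff₀ hb2] at hs
      nlinarith
    have hr1 := hrpc (b + 1)
    have h1 : IntegrableOn (fun t => t ^ (b + 1) * (φx t + φy t)) (Set.Ioi t₀) := by
      refine intOn_dom t₀ (1 / (θ - θ ^ 2 * (b + 2))) D _ hDint (by fun_prop) ?_
      intro t ht
      have htp : 0 < t := by linarith
      have := hφx0 t
      have := hφy0 t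
      rw [abs_of_nonneg (by positivity), one_div_mul_eq_div, le_div_iff₀ hd1]
      simp only [hD]
      linarith [hD2 t ht.le]
    refine ⟨h1, ?_, ?_⟩
    · refine intOn_dom t₀ (2 * L₁) _ _ h1 ?_ ?_
      · have := hfgc.comp_continuousOn hxc
        exact hr1.mul ((this.sub continuousOn_const).norm.pow 2)
      · intro t ht
        have htp : 0 < t := by linarith
        rw [abs_of_nonneg (by positivity), mul_left_comm]
        refine mul_le_mul_of_nonneg_left ((hGx t).trans ?_) (by positivity)
        refine mul_le_mul_of_nonneg_left ?_ (by positivity)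
        have h2 := hφy0 t
        simp only [hφx] at *
        linarith
    · refine intOn_dom t₀ (2 * L₂) _ _ h1 ?_ ?_
      · have := hggc.comp_continuousOn hyc
        exact hr1.mul ((this.sub continuousOn_const).norm.pow 2)
      · intro t ht
        have htp : 0 < t := by linarith
        rw [abs_of_nonneg (by positivity), mul_left_comm]
        refine mul_le_mul_of_nonneg_left ((hGy t).trans ?_) (by positivity)
        refine mul_le_mul_of_nonneg_left ?_ (by positivity)
        have h2 := hφx0 t
        simp only [hφy] at *
        linarith
  · refine tendsto_of_tendsto_of_tendsto_of_le_of_le' tendsto_const_nhds (hvel Cx)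
      (Filter.Eventually.of_forall fun t => norm_nonneg _) ?_
    filter_upwards [eventually_ge_atTop t₀] with t ht using (hCx t ht).2
  · refine tendsto_of_tendsto_of_tendsto_of_le_of_le' tendsto_const_nhds (hvel Cy)
      (Filter.Eventually.of_forall fun t => norm_nonneg _) ?_
    filter_upwards [eventually_ge_atTop t₀] with t ht using (hCy t ht).2
  · have := littleO_aux (fun t => φx t + φy t) t₀ (M / θ ^ 2) (-2 - b) 0 (by linarith)
      (fun t ht => ⟨add_nonneg (hφx0 t) (hφy0 t), hφb t ht⟩)
    simp only [Real.rpow_zero] at this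
    exact (isLittleO_one_iff ℝ).1 this
  · intro _
    exact ⟨littleO_aux _ t₀ _ _ _ (by linarith)
        (fun t ht => ⟨add_nonneg (hφx0 t) (hφy0 t), hφb t ht⟩),
      littleO_aux _ t₀ _ _ _ (by linarith) (fun t ht => ⟨norm_nonneg _, hGxb t ht⟩),
      littleO_aux _ t₀ _ _ _ (by linarith) (fun t ht => ⟨norm_nonneg _, hGyb t ht⟩)⟩
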